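/- Let T4 be the ℂ-subalgebra of Maps(M2(ℂ)^4, ℂ) generated by the functions t_i (1 ≤ i ≤ 4), s_{ij} (1 ≤ i ≤ j ≤ 4), and s_{ijk} (1 ≤ i < j < k ≤ 4), and let R be the ℂ-subalgebra generated by t1, t2, t3, t4, s11, s22, s33, s44, s12, s23, s34, s14. Then T4, regarded as an R-module, is free with basis E = {1, s13, s24, s13·s24} ∪ {s13^k, s13^k·s24, s24^k, s24^k·s13 : k ≥ 2} ∪ {s13^k·s123, s13^k·s134, s24^k·s124, s24^k·s234 : k ≥ 0}. -/

import Mathlib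

/-- The 2×2 complex matrices. -/
abbrev M2 : Type := Matrix (Fin 2) (Fin 2) ℂ

/-- The traceless part `[[y]] = y - (1/2)·tr(y)·I` of a 2×2 complex matrix. -/
noncomputable def tl (y : M2) : M2 := y - (Matrix.trace y / 2) • (1 : M2)

/-- The function `t_i` on quadruples of 2×2 matrices: `x ↦ tr(x_i)`.
(Indices are 0-based: `tfun 0` is `t₁`, ..., `tfun 3` is `t₄`.) -/
noncomputable def tfun (i : Fin 4) : (Fin 4 → M2) → ℂ := fun x => Matrix.trace (x i)

/-- The function `s_{ij}` on quadruples of 2×2 matrices: `x ↦ tr([[x_i]]·[[x_j]])`. -/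
noncomputable def sfun (i j : Fin 4) : (Fin 4 → M2) → ℂ :=
  fun x => Matrix.trace (tl (x i) * tl (x j))

/-- The function `s_{ijk}` on quadruples of 2×2 matrices: `x ↦ tr([[x_i]]·[[x_j]]·[[x_k]])`. -/
noncomputable def sfun3 (i j k : Fin 4) : (Fin 4 → M2) → ℂ :=
  fun x => Matrix.trace (tl (x i) * tl (x j) * tl (x k))

/-- The ℂ-subalgebra `T₄` of the algebra of functions `M₂(ℂ)⁴ → ℂ`, generated by the
`t_i` (1 ≤ i ≤ 4), the `s_{ij}` (1 ≤ i ≤ j ≤ 4) and the `s_{ijk}` (1 ≤ i < j < k ≤ 4). -/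
noncomputable def T4 : Subalgebra ℂ ((Fin 4 → M2) → ℂ) :=
  Algebra.adjoin ℂ
    {f | (∃ i, f = tfun i) ∨ (∃ i j, i ≤ j ∧ f = sfun i j) ∨
      (∃ i j k, i < j ∧ j < k ∧ f = sfun3 i j k)}

/-- The ℂ-subalgebra `R` generated by t₁, t₂, t₃, t₄, s₁₁, s₂₂, s₃₃, s₄₄, s₁₂, s₂₃, s₃₄, s₁₄. -/
noncomputable def Ralg : Subalgebra ℂ ((Fin 4 → M2) → ℂ) :=
  Algebra.adjoin ℂ
    {tfun 0, tfun 1, tfun 2, tfun 3, sfun 0 0, sfun 1 1, sfun 2 2, sfun 3 3,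
     sfun 0 1, sfun 1 2, sfun 2 3, sfun 0 3}

/-- The set `E = {1, s₁₃, s₂₄, s₁₃s₂₄} ∪ {s₁₃ᵏ, s₁₃ᵏs₂₄, s₂₄ᵏ, s₂₄ᵏs₁₃ : k ≥ 2}
∪ {s₁₃ᵏs₁₂₃, s₁₃ᵏs₁₃₄, s₂₄ᵏs₁₂₄, s₂₄ᵏs₂₃₄ : k ≥ 0}`. -/
noncomputable def Eset : Set ((Fin 4 → M2) → ℂ) :=
  {1, sfun 0 2, sfun 1 3, sfun 0 2 * sfun 1 3} ∪
  {f | ∃ k : ℕ, 2 ≤ k ∧ (f = sfun 0 2 ^ k ∨ f = sfun 0 2 ^ k * sfun 1 3 ∨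
    f = sfun 1 3 ^ k ∨ f = sfun 1 3 ^ k * sfun 0 2)} ∪
  {f | ∃ k : ℕ, f = sfun 0 2 ^ k * sfun3 0 1 2 ∨ f = sfun 0 2 ^ k * sfun3 0 2 3 ∨
    f = sfun 1 3 ^ k * sfun3 0 1 3 ∨ f = sfun 1 3 ^ k * sfun3 1 2 3}


/-! ### Coordinate formulas -/

lemma tl_eq (y : M2) : tl y = !![(y 0 0 - y 1 1) / 2, y 0 1; y 1 0, -((y 0 0 - y 1 1) / 2)] := by
  ext i j
  fin_cases i <;> fin_cases j <;> simp [tl, Matrix.trace_fin_two] <;> ring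

lemma sfun_eq (i j : Fin 4) (x : Fin 4 → M2) :
    sfun i j x = 2 * ((x i 0 0 - x i 1 1) / 2) * ((x j 0 0 - x j 1 1) / 2)
      + x i 0 1 * x j 1 0 + x i 1 0 * x j 0 1 := by
  simp [sfun, tl_eq, Matrix.trace_fin_two]
  ring

lemma sfun3_eq (i j k : Fin 4) (x : Fin 4 → M2) :
    sfun3 i j k x = ((x i 0 0 - x i 1 1) / 2) * (x j 0 1 * x k 1 0 - x j 1 0 * x k 0 1)
      + ((x j 0 0 - x j 1 1) / 2) * (x k 0 1 * x i 1 0 - x k 1 0 * x i 0 1)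
      + ((x k 0 0 - x k 1 1) / 2) * (x i 0 1 * x j 1 0 - x i 1 0 * x j 0 1) := by
  simp [sfun3, tl_eq, Matrix.trace_fin_two]
  ring

lemma sfun_symm (i j : Fin 4) : sfun i j = sfun j i := by
  ext x; simp only [sfun_eq]; ring

lemma sfun3_cyc (i j k : Fin 4) : sfun3 i j k = sfun3 j k i := by
  ext x; simp only [sfun3_eq]; ring

/-- Product of two triple traces is a Gram determinant. -/
lemma sfun3_mul (i j k l m n : Fin 4) :
    sfun3 i j k * sfun3 l m n = (-1 / 2 : ℂ) •
      (sfun i l * (sfun j m * sfun k n - sfun j n * sfun k m)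
        - sfun i m * (sfun j l * sfun k n - sfun j n * sfun k l)
        + sfun i n * (sfun j l * sfun k m - sfun j m * sfun k l)) := by
  ext x
  simp only [Pi.mul_apply, Pi.smul_apply, Pi.add_apply, Pi.sub_apply, smul_eq_mul, sfun_eq,
    sfun3_eq]
  ring

/-- The linear syzygies. -/
lemma syz (l : Fin 4) :
    sfun l 0 * sfun3 1 2 3 - sfun l 1 * sfun3 0 2 3 + sfun l 2 * sfun3 0 1 3
      - sfun l 3 * sfun3 0 1 2 = 0 := by
  ext x
  simp only [Pi.mul_apply, Pi.add_apply, Pi.sub_apply, Pi.zero_apply, sfun_eq,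
    sfun3_eq]
  ring

/-- The Gram determinant relation, solved for the leading monomial. -/
lemma gram_rel (x : Fin 4 → M2) :
    sfun 0 2 x ^ 2 * sfun 1 3 x ^ 2 =
      (sfun 1 1 x * sfun 3 3 x) * sfun 0 2 x ^ 2 + (sfun 0 0 x * sfun 2 2 x) * sfun 1 3 x ^ 2
      + 2 * (sfun 0 1 x * sfun 2 3 x + sfun 1 2 x * sfun 0 3 x) * (sfun 0 2 x * sfun 1 3 x)
      - 2 * (sfun 0 1 x * sfun 1 2 x * sfun 3 3 x + sfun 2 3 x * sfun 0 3 x * sfun 1 1 x)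
        * sfun 0 2 x
      - 2 * (sfun 0 1 x * sfun 0 3 x * sfun 2 2 x + sfun 1 2 x * sfun 2 3 x * sfun 0 0 x)
        * sfun 1 3 x
      - (sfun 0 0 x * sfun 1 1 x * sfun 2 2 x * sfun 3 3 x - sfun 0 1 x ^ 2 * sfun 2 2 x * sfun 3 3 x
        - sfun 0 3 x ^ 2 * sfun 1 1 x * sfun 2 2 x - sfun 1 2 x ^ 2 * sfun 0 0 x * sfun 3 3 x
        - sfun 2 3 x ^ 2 * sfun 0 0 x * sfun 1 1 x + sfun 0 1 x ^ 2 * sfun 2 3 x ^ 2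
        + sfun 0 3 x ^ 2 * sfun 1 2 x ^ 2
        - 2 * (sfun 0 1 x * sfun 1 2 x * sfun 2 3 x * sfun 0 3 x)) := by
  simp only [sfun_eq]
  ring

/-! ### `E ⊆ T₄` -/

lemma sfun_mem_T4 (i j : Fin 4) : sfun i j ∈ T4 := by
  rcases le_total i j with h | h
  · exact Algebra.subset_adjoin (Or.inr (Or.inl ⟨i, j, h, rfl⟩))
  · rw [sfun_symm]
    exact Algebra.subset_adjoin (Or.inr (Or.inl ⟨j, i, h, rfl⟩))

lemma sfun3_mem_T4 (i j k : Fin 4) (h : i < j) (h' : j < k) : sfun3 i j k ∈ T4 :=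
  Algebra.subset_adjoin (Or.inr (Or.inr ⟨i, j, k, h, h', rfl⟩))

lemma Eset_subset : Eset ⊆ (T4 : Set ((Fin 4 → M2) → ℂ)) := by
  have ha := sfun_mem_T4 0 2
  have hb := sfun_mem_T4 1 3
  have h1 := sfun3_mem_T4 0 1 2 (by decide) (by decide)
  have h2 := sfun3_mem_T4 0 2 3 (by decide) (by decide)
  have h3 := sfun3_mem_T4 0 1 3 (by decide) (by decide)
  have h4 := sfun3_mem_T4 1 2 3 (by decide) (by decide)
  rintro f ((hf | ⟨k, -, hf⟩) | ⟨k, hf⟩)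
  · rcases hf with rfl | rfl | rfl | rfl
    · exact one_mem T4
    · exact ha
    · exact hb
    · exact mul_mem ha hb
  · rcases hf with rfl | rfl | rfl | rfl
    · exact pow_mem ha k
    · exact mul_mem (pow_mem ha k) hb
    · exact pow_mem hb k
    · exact mul_mem (pow_mem hb k) ha
  · rcases hf with rfl | rfl | rfl | rfl
    · exact mul_mem (pow_mem ha k) h1
    · exact mul_mem (pow_mem ha k) h2
    · exact mul_mem (pow_mem hb k) h3
    · exact mul_mem (pow_mem hb k) h4

/-! ### Spanning -/

/-- The `R`-span of `E`. -/
noncomputable def Sp : Submodule Ralg ((Fin 4 → M2) → ℂ) := Submodule.span Ralg Eset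

/-- Multipliers preserving the span. -/
noncomputable def Qalg : Subalgebra ℂ ((Fin 4 → M2) → ℂ) where
  carrier := {f | ∀ s ∈ Sp, f * s ∈ Sp}
  mul_mem' := by
    intro f g hf hg s hs
    rw [mul_assoc]
    exact hf _ (hg _ hs)
  add_mem' := by
    intro f g hf hg s hs
    rw [add_mul]
    exact add_mem (hf _ hs) (hg _ hs)
  algebraMap_mem' := by
    intro c s hs
    exact Sp.smul_mem (algebraMap ℂ Ralg c) hs

lemma mul_Sp {r f : (Fin 4 → M2) → ℂ} (hr : r ∈ Ralg) (hf : f ∈ Sp) : r * f ∈ Sp :=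
  Sp.smul_mem (⟨r, hr⟩ : Ralg) hf

lemma Ralg_le_Qalg : Ralg ≤ Qalg := fun _ hr _ hs => mul_Sp hr hs

lemma sR00 : sfun 0 0 ∈ Ralg := Algebra.subset_adjoin (by simp)
lemma sR11 : sfun 1 1 ∈ Ralg := Algebra.subset_adjoin (by simp)
lemma sR22 : sfun 2 2 ∈ Ralg := Algebra.subset_adjoin (by simp)
lemma sR33 : sfun 3 3 ∈ Ralg := Algebra.subset_adjoin (by simp)
lemma sR01 : sfun 0 1 ∈ Ralg := Algebra.subset_adjoin (by simp)
lemma sR12 : sfun 1 2 ∈ Ralg := Algebra.subset_adjoin (by simp)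
lemma sR23 : sfun 2 3 ∈ Ralg := Algebra.subset_adjoin (by simp)
lemma sR03 : sfun 0 3 ∈ Ralg := Algebra.subset_adjoin (by simp)

lemma tR (i : Fin 4) : tfun i ∈ Ralg := by
  fin_cases i <;> exact Algebra.subset_adjoin (by simp)

lemma Sp_a (k : ℕ) : sfun 0 2 ^ k ∈ Sp := by
  apply Submodule.subset_span
  rcases k with _ | _ | k
  · left; left; simp
  · left; left; simp
  · left; right; exact ⟨k + 2, by omega, Or.inl rfl⟩

lemma Sp_ab (k : ℕ) : sfun 0 2 ^ k * sfun 1 3 ∈ Sp := by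
  apply Submodule.subset_span
  rcases k with _ | _ | k
  · left; left; simp
  · left; left; simp
  · left; right; exact ⟨k + 2, by omega, Or.inr (Or.inl rfl)⟩

lemma Sp_b (k : ℕ) : sfun 1 3 ^ k ∈ Sp := by
  apply Submodule.subset_span
  rcases k with _ | _ | k
  · left; left; simp
  · left; left; simp
  · left; right; exact ⟨k + 2, by omega, Or.inr (Or.inr (Or.inl rfl))⟩

lemma Sp_ba (k : ℕ) : sfun 1 3 ^ k * sfun 0 2 ∈ Sp := by
  apply Submodule.subset_span
  rcases k with _ | _ | k
  · left; left; simp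
  · left; left; simp [mul_comm]
  · left; right; exact ⟨k + 2, by omega, Or.inr (Or.inr (Or.inr rfl))⟩

lemma Sp_aD4 (k : ℕ) : sfun 0 2 ^ k * sfun3 0 1 2 ∈ Sp :=
  Submodule.subset_span (Or.inr ⟨k, Or.inl rfl⟩)
lemma Sp_aD2 (k : ℕ) : sfun 0 2 ^ k * sfun3 0 2 3 ∈ Sp :=
  Submodule.subset_span (Or.inr ⟨k, Or.inr (Or.inl rfl)⟩)
lemma Sp_bD3 (k : ℕ) : sfun 1 3 ^ k * sfun3 0 1 3 ∈ Sp :=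
  Submodule.subset_span (Or.inr ⟨k, Or.inr (Or.inr (Or.inl rfl))⟩)
lemma Sp_bD1 (k : ℕ) : sfun 1 3 ^ k * sfun3 1 2 3 ∈ Sp :=
  Submodule.subset_span (Or.inr ⟨k, Or.inr (Or.inr (Or.inr rfl))⟩)

lemma Sp_one : (1 : (Fin 4 → M2) → ℂ) ∈ Sp := by simpa using Sp_a 0

/-- Coefficients of the Gram determinant lie in `R`. -/
lemma gram_rel' : ∃ r1 ∈ Ralg, ∃ r2 ∈ Ralg, ∃ r3 ∈ Ralg, ∃ r4 ∈ Ralg, ∃ r5 ∈ Ralg, ∃ r6 ∈ Ralg,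
    sfun 0 2 ^ 2 * sfun 1 3 ^ 2 = r1 * sfun 0 2 ^ 2 + r2 * sfun 1 3 ^ 2
      + r3 * (sfun 0 2 * sfun 1 3) + r4 * sfun 0 2 + r5 * sfun 1 3 + r6 := by
  have h2 : (2 : (Fin 4 → M2) → ℂ) ∈ Ralg := by
    have := add_mem (one_mem Ralg) (one_mem Ralg)
    rwa [one_add_one_eq_two] at this
  refine ⟨sfun 1 1 * sfun 3 3, mul_mem sR11 sR33, sfun 0 0 * sfun 2 2, mul_mem sR00 sR22,
    2 * (sfun 0 1 * sfun 2 3 + sfun 1 2 * sfun 0 3),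
    mul_mem h2 (add_mem (mul_mem sR01 sR23) (mul_mem sR12 sR03)),
    -(2 * (sfun 0 1 * sfun 1 2 * sfun 3 3 + sfun 2 3 * sfun 0 3 * sfun 1 1)),
    neg_mem (mul_mem h2 (add_mem (mul_mem (mul_mem sR01 sR12) sR33)
      (mul_mem (mul_mem sR23 sR03) sR11))),
    -(2 * (sfun 0 1 * sfun 0 3 * sfun 2 2 + sfun 1 2 * sfun 2 3 * sfun 0 0)),
    neg_mem (mul_mem h2 (add_mem (mul_mem (mul_mem sR01 sR03) sR22)
      (mul_mem (mul_mem sR12 sR23) sR00))),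
    -(sfun 0 0 * sfun 1 1 * sfun 2 2 * sfun 3 3 - sfun 0 1 ^ 2 * sfun 2 2 * sfun 3 3
        - sfun 0 3 ^ 2 * sfun 1 1 * sfun 2 2 - sfun 1 2 ^ 2 * sfun 0 0 * sfun 3 3
        - sfun 2 3 ^ 2 * sfun 0 0 * sfun 1 1 + sfun 0 1 ^ 2 * sfun 2 3 ^ 2
        + sfun 0 3 ^ 2 * sfun 1 2 ^ 2
        - 2 * (sfun 0 1 * sfun 1 2 * sfun 2 3 * sfun 0 3)), ?_, ?_⟩
  · have := sR00; have := sR11; have := sR22; have := sR33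
    have := sR01; have := sR12; have := sR23; have := sR03
    refine neg_mem (sub_mem (add_mem (add_mem (sub_mem (sub_mem (sub_mem (sub_mem ?_ ?_) ?_) ?_) ?_)
      ?_) ?_) (mul_mem h2 ?_)) <;>
    repeat' (first | assumption | with_reducible apply pow_mem | with_reducible apply mul_mem)
  · ext x
    have := gram_rel x
    simp only [Pi.mul_apply, Pi.add_apply, Pi.sub_apply, Pi.neg_apply, Pi.pow_apply,
      Pi.ofNat_apply]
    linear_combination this

lemma Sp_a2b (k : ℕ) : sfun 0 2 ^ 2 * sfun 1 3 ^ k ∈ Sp := by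
  induction k using Nat.strong_induction_on with
  | _ k ih =>
    rcases k with _ | _ | k
    · simpa using Sp_a 2
    · simpa using Sp_ab 2
    · obtain ⟨r1, h1, r2, h2, r3, h3, r4, h4, r5, h5, r6, h6, h⟩ := gram_rel'
      have e : sfun 0 2 ^ 2 * sfun 1 3 ^ (k + 1 + 1) =
          r1 * (sfun 0 2 ^ 2 * sfun 1 3 ^ k) + r2 * sfun 1 3 ^ (k + 2)
          + r3 * (sfun 1 3 ^ (k + 1) * sfun 0 2) + r4 * (sfun 1 3 ^ k * sfun 0 2)
          + r5 * sfun 1 3 ^ (k + 1) + r6 * sfun 1 3 ^ k := by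
        linear_combination (sfun 1 3 ^ k) * h
      rw [e]
      exact add_mem (add_mem (add_mem (add_mem (add_mem (mul_Sp h1 (ih k (by omega)))
        (mul_Sp h2 (Sp_b _))) (mul_Sp h3 (Sp_ba _))) (mul_Sp h4 (Sp_ba _)))
        (mul_Sp h5 (Sp_b _))) (mul_Sp h6 (Sp_b _))

lemma Sp_b2a (k : ℕ) : sfun 1 3 ^ 2 * sfun 0 2 ^ k ∈ Sp := by
  induction k using Nat.strong_induction_on with
  | _ k ih =>
    rcases k with _ | _ | k
    · simpa using Sp_b 2
    · simpa using Sp_ba 2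
    · obtain ⟨r1, h1, r2, h2, r3, h3, r4, h4, r5, h5, r6, h6, h⟩ := gram_rel'
      have e : sfun 1 3 ^ 2 * sfun 0 2 ^ (k + 1 + 1) =
          r1 * sfun 0 2 ^ (k + 2) + r2 * (sfun 1 3 ^ 2 * sfun 0 2 ^ k)
          + r3 * (sfun 0 2 ^ (k + 1) * sfun 1 3) + r4 * sfun 0 2 ^ (k + 1)
          + r5 * (sfun 0 2 ^ k * sfun 1 3) + r6 * sfun 0 2 ^ k := by
        linear_combination (sfun 0 2 ^ k) * h
      rw [e]
      exact add_mem (add_mem (add_mem (add_mem (add_mem (mul_Sp h1 (Sp_a _))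
        (mul_Sp h2 (ih k (by omega)))) (mul_Sp h3 (Sp_ab _))) (mul_Sp h4 (Sp_a _)))
        (mul_Sp h5 (Sp_ab _))) (mul_Sp h6 (Sp_a _))

lemma syz0 : sfun 0 2 * sfun3 0 1 3 = -(sfun 0 0 * sfun3 1 2 3) + sfun 0 1 * sfun3 0 2 3
    + sfun 0 3 * sfun3 0 1 2 := by
  linear_combination syz 0
lemma syz1 : sfun 1 3 * sfun3 0 1 2 = sfun 0 1 * sfun3 1 2 3 - sfun 1 1 * sfun3 0 2 3
    + sfun 1 2 * sfun3 0 1 3 := by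
  have := syz 1
  rw [sfun_symm 1 0] at this
  linear_combination -this
lemma syz2 : sfun 0 2 * sfun3 1 2 3 = sfun 1 2 * sfun3 0 2 3 - sfun 2 2 * sfun3 0 1 3
    + sfun 2 3 * sfun3 0 1 2 := by
  have := syz 2
  rw [sfun_symm 2 0, sfun_symm 2 1] at this
  linear_combination this
lemma syz3 : sfun 1 3 * sfun3 0 2 3 = sfun 0 3 * sfun3 1 2 3 + sfun 2 3 * sfun3 0 1 3
    - sfun 3 3 * sfun3 0 1 2 := by
  have := syz 3
  rw [sfun_symm 3 0, sfun_symm 3 1, sfun_symm 3 2] at this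
  linear_combination -this

lemma Sp_bD24 (k : ℕ) : sfun 1 3 ^ k * sfun3 0 2 3 ∈ Sp ∧ sfun 1 3 ^ k * sfun3 0 1 2 ∈ Sp := by
  induction k with
  | zero => exact ⟨by simpa using Sp_aD2 0, by simpa using Sp_aD4 0⟩
  | succ k ih =>
    constructor
    · have e : sfun 1 3 ^ (k + 1) * sfun3 0 2 3 = sfun 0 3 * (sfun 1 3 ^ k * sfun3 1 2 3)
          + sfun 2 3 * (sfun 1 3 ^ k * sfun3 0 1 3) - sfun 3 3 * (sfun 1 3 ^ k * sfun3 0 1 2) := by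
        linear_combination (sfun 1 3 ^ k) * syz3
      rw [e]
      exact sub_mem (add_mem (mul_Sp sR03 (Sp_bD1 k)) (mul_Sp sR23 (Sp_bD3 k))) (mul_Sp sR33 ih.2)
    · have e : sfun 1 3 ^ (k + 1) * sfun3 0 1 2 = sfun 0 1 * (sfun 1 3 ^ k * sfun3 1 2 3)
          - sfun 1 1 * (sfun 1 3 ^ k * sfun3 0 2 3) + sfun 1 2 * (sfun 1 3 ^ k * sfun3 0 1 3) := by
        linear_combination (sfun 1 3 ^ k) * syz1
      rw [e]
      exact add_mem (sub_mem (mul_Sp sR01 (Sp_bD1 k)) (mul_Sp sR11 ih.1)) (mul_Sp sR12 (Sp_bD3 k))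

lemma Sp_aD31 (k : ℕ) : sfun 0 2 ^ k * sfun3 0 1 3 ∈ Sp ∧ sfun 0 2 ^ k * sfun3 1 2 3 ∈ Sp := by
  induction k with
  | zero => exact ⟨by simpa using Sp_bD3 0, by simpa using Sp_bD1 0⟩
  | succ k ih =>
    constructor
    · have e : sfun 0 2 ^ (k + 1) * sfun3 0 1 3 = -(sfun 0 0 * (sfun 0 2 ^ k * sfun3 1 2 3))
          + sfun 0 1 * (sfun 0 2 ^ k * sfun3 0 2 3) + sfun 0 3 * (sfun 0 2 ^ k * sfun3 0 1 2) := by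
        linear_combination (sfun 0 2 ^ k) * syz0
      rw [e]
      exact add_mem (add_mem (neg_mem (mul_Sp sR00 ih.2)) (mul_Sp sR01 (Sp_aD2 k)))
        (mul_Sp sR03 (Sp_aD4 k))
    · have e : sfun 0 2 ^ (k + 1) * sfun3 1 2 3 = sfun 1 2 * (sfun 0 2 ^ k * sfun3 0 2 3)
          - sfun 2 2 * (sfun 0 2 ^ k * sfun3 0 1 3) + sfun 2 3 * (sfun 0 2 ^ k * sfun3 0 1 2) := by
        linear_combination (sfun 0 2 ^ k) * syz2
      rw [e]
      exact add_mem (sub_mem (mul_Sp sR12 (Sp_aD2 k)) (mul_Sp sR22 ih.1)) (mul_Sp sR23 (Sp_aD4 k))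

/-- To be a multiplier it is enough to multiply `E` into the span. -/
lemma mem_Qalg {f : (Fin 4 → M2) → ℂ} (h : ∀ e ∈ Eset, f * e ∈ Sp) : f ∈ Qalg := by
  intro s hs
  induction hs using Submodule.span_induction with
  | mem e he => exact h e he
  | zero => rw [mul_zero]; exact zero_mem _
  | add x y _ _ hx hy => rw [mul_add]; exact add_mem hx hy
  | smul r x _ hx =>
    rw [mul_smul_comm]
    exact Sp.smul_mem r hx

lemma a_mem_Qalg : sfun 0 2 ∈ Qalg := by
  apply mem_Qalg
  rintro f ((hf | ⟨k, -, hf⟩) | ⟨k, hf⟩)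
  · rcases hf with rfl | rfl | rfl | rfl
    · simpa using Sp_a 1
    · simpa [pow_two] using Sp_a 2
    · simpa using Sp_ab 1
    · simpa [pow_two, mul_assoc] using Sp_ab 2
  · rcases hf with rfl | rfl | rfl | rfl
    · rw [← pow_succ']; exact Sp_a _
    · rw [← mul_assoc, ← pow_succ']; exact Sp_ab _
    · rw [mul_comm]; exact Sp_ba _
    · rw [show sfun 0 2 * (sfun 1 3 ^ k * sfun 0 2) = sfun 0 2 ^ 2 * sfun 1 3 ^ k by ring]
      exact Sp_a2b k
  · rcases hf with rfl | rfl | rfl | rfl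
    · rw [← mul_assoc, ← pow_succ']; exact Sp_aD4 _
    · rw [← mul_assoc, ← pow_succ']; exact Sp_aD2 _
    · have e : sfun 0 2 * (sfun 1 3 ^ k * sfun3 0 1 3) = -(sfun 0 0 * (sfun 1 3 ^ k * sfun3 1 2 3))
          + sfun 0 1 * (sfun 1 3 ^ k * sfun3 0 2 3) + sfun 0 3 * (sfun 1 3 ^ k * sfun3 0 1 2) := by
        linear_combination (sfun 1 3 ^ k) * syz0
      rw [e]
      exact add_mem (add_mem (neg_mem (mul_Sp sR00 (Sp_bD1 k))) (mul_Sp sR01 (Sp_bD24 k).1))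
        (mul_Sp sR03 (Sp_bD24 k).2)
    · have e : sfun 0 2 * (sfun 1 3 ^ k * sfun3 1 2 3) = sfun 1 2 * (sfun 1 3 ^ k * sfun3 0 2 3)
          - sfun 2 2 * (sfun 1 3 ^ k * sfun3 0 1 3) + sfun 2 3 * (sfun 1 3 ^ k * sfun3 0 1 2) := by
        linear_combination (sfun 1 3 ^ k) * syz2
      rw [e]
      exact add_mem (sub_mem (mul_Sp sR12 (Sp_bD24 k).1) (mul_Sp sR22 (Sp_bD3 k)))
        (mul_Sp sR23 (Sp_bD24 k).2)

lemma b_mem_Qalg : sfun 1 3 ∈ Qalg := by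
  apply mem_Qalg
  rintro f ((hf | ⟨k, -, hf⟩) | ⟨k, hf⟩)
  · rcases hf with rfl | rfl | rfl | rfl
    · simpa using Sp_b 1
    · simpa using Sp_ba 1
    · simpa [pow_two] using Sp_b 2
    · rw [show sfun 1 3 * (sfun 0 2 * sfun 1 3) = sfun 1 3 ^ 2 * sfun 0 2 by ring]
      exact Sp_ba 2
  · rcases hf with rfl | rfl | rfl | rfl
    · rw [mul_comm]; exact Sp_ab _
    · rw [show sfun 1 3 * (sfun 0 2 ^ k * sfun 1 3) = sfun 1 3 ^ 2 * sfun 0 2 ^ k by ring]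
      exact Sp_b2a k
    · rw [← pow_succ']; exact Sp_b _
    · rw [← mul_assoc, ← pow_succ']; exact Sp_ba _
  · rcases hf with rfl | rfl | rfl | rfl
    · have e : sfun 1 3 * (sfun 0 2 ^ k * sfun3 0 1 2) = sfun 0 1 * (sfun 0 2 ^ k * sfun3 1 2 3)
          - sfun 1 1 * (sfun 0 2 ^ k * sfun3 0 2 3) + sfun 1 2 * (sfun 0 2 ^ k * sfun3 0 1 3) := by
        linear_combination (sfun 0 2 ^ k) * syz1
      rw [e]
      exact add_mem (sub_mem (mul_Sp sR01 (Sp_aD31 k).2) (mul_Sp sR11 (Sp_aD2 k)))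
        (mul_Sp sR12 (Sp_aD31 k).1)
    · have e : sfun 1 3 * (sfun 0 2 ^ k * sfun3 0 2 3) = sfun 0 3 * (sfun 0 2 ^ k * sfun3 1 2 3)
          + sfun 2 3 * (sfun 0 2 ^ k * sfun3 0 1 3) - sfun 3 3 * (sfun 0 2 ^ k * sfun3 0 1 2) := by
        linear_combination (sfun 0 2 ^ k) * syz3
      rw [e]
      exact sub_mem (add_mem (mul_Sp sR03 (Sp_aD31 k).2) (mul_Sp sR23 (Sp_aD31 k).1))
        (mul_Sp sR33 (Sp_aD4 k))
    · rw [← mul_assoc, ← pow_succ']; exact Sp_bD3 _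
    · rw [← mul_assoc, ← pow_succ']; exact Sp_bD1 _

lemma sfun_mem_Qalg' (i j : Fin 4) (h : i ≤ j) : sfun i j ∈ Qalg := by
  fin_cases i <;> fin_cases j <;>
  first
  | exact a_mem_Qalg
  | exact b_mem_Qalg
  | exact Ralg_le_Qalg sR00
  | exact Ralg_le_Qalg sR11
  | exact Ralg_le_Qalg sR22
  | exact Ralg_le_Qalg sR33
  | exact Ralg_le_Qalg sR01
  | exact Ralg_le_Qalg sR12
  | exact Ralg_le_Qalg sR23
  | exact Ralg_le_Qalg sR03
  | exact absurd h (by decide)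

lemma sfun_mem_Qalg (i j : Fin 4) : sfun i j ∈ Qalg := by
  rcases le_total i j with h | h
  · exact sfun_mem_Qalg' i j h
  · rw [sfun_symm]
    exact sfun_mem_Qalg' j i h

lemma sfun3_mul_mem_Qalg (i j k l m n : Fin 4) : sfun3 i j k * sfun3 l m n ∈ Qalg := by
  rw [sfun3_mul]
  apply Subalgebra.smul_mem
  have h := sfun_mem_Qalg
  exact add_mem (sub_mem
    (mul_mem (h _ _) (sub_mem (mul_mem (h _ _) (h _ _)) (mul_mem (h _ _) (h _ _))))
    (mul_mem (h _ _) (sub_mem (mul_mem (h _ _) (h _ _)) (mul_mem (h _ _) (h _ _)))))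
    (mul_mem (h _ _) (sub_mem (mul_mem (h _ _) (h _ _)) (mul_mem (h _ _) (h _ _))))

lemma sfun3_mem_Sp (i j k : Fin 4) (h : i < j) (h' : j < k) : sfun3 i j k ∈ Sp := by
  have h1 : sfun3 0 1 2 ∈ Sp := by simpa using Sp_aD4 0
  have h2 : sfun3 0 2 3 ∈ Sp := by simpa using Sp_aD2 0
  have h3 : sfun3 0 1 3 ∈ Sp := by simpa using Sp_bD3 0
  have h4 : sfun3 1 2 3 ∈ Sp := by simpa using Sp_bD1 0
  fin_cases i <;> fin_cases j <;>
  first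
  | exact absurd h (by decide)
  | (fin_cases k <;>
      first
      | exact absurd h' (by decide)
      | exact h1
      | exact h2
      | exact h3
      | exact h4)

lemma sfun3_mem_Qalg (i j k : Fin 4) (h : i < j) (h' : j < k) : sfun3 i j k ∈ Qalg := by
  have hD := sfun3_mem_Sp i j k h h'
  have ha := a_mem_Qalg
  have hb := b_mem_Qalg
  have key : ∀ g ∈ Qalg, sfun3 i j k * g ∈ Sp := by
    intro g hg
    rw [mul_comm]
    exact hg _ hD
  have key2 : ∀ g ∈ Qalg, ∀ l m n, sfun3 i j k * (g * sfun3 l m n) ∈ Sp := by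
    intro g hg l m n
    have := mul_mem hg (sfun3_mul_mem_Qalg i j k l m n) 1 Sp_one
    rw [mul_one] at this
    rwa [mul_left_comm]
  apply mem_Qalg
  rintro f ((hf | ⟨k, -, hf⟩) | ⟨k, hf⟩)
  · rcases hf with rfl | rfl | rfl | rfl
    · exact key _ (one_mem _)
    · exact key _ ha
    · exact key _ hb
    · exact key _ (mul_mem ha hb)
  · rcases hf with rfl | rfl | rfl | rfl
    · exact key _ (pow_mem ha k)
    · exact key _ (mul_mem (pow_mem ha k) hb)
    · exact key _ (pow_mem hb k)
    · exact key _ (mul_mem (pow_mem hb k) ha)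
  · rcases hf with rfl | rfl | rfl | rfl
    · exact key2 _ (pow_mem ha k) _ _ _
    · exact key2 _ (pow_mem ha k) _ _ _
    · exact key2 _ (pow_mem hb k) _ _ _
    · exact key2 _ (pow_mem hb k) _ _ _

lemma T4_le_Qalg : T4 ≤ Qalg := by
  apply Algebra.adjoin_le
  rintro f (⟨i, rfl⟩ | ⟨i, j, h, rfl⟩ | ⟨i, j, k, h, h', rfl⟩)
  · exact Ralg_le_Qalg (tR i)
  · exact sfun_mem_Qalg i j
  · exact sfun3_mem_Qalg i j k h h'

lemma T4_span : ∀ f ∈ T4, f ∈ Submodule.span Ralg Eset := by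
  intro f hf
  have := T4_le_Qalg hf 1 Sp_one
  rwa [mul_one] at this

/-! ### Realizing symmetric matrices as Gram matrices -/

/-- A singular complex symmetric `4 × 4` matrix is the Gram matrix of four vectors in `ℂ³`. -/
lemma exists_gram (G : Matrix (Fin 4) (Fin 4) ℂ) (hG : G.IsSymm) (hdet : G.det = 0) :
    ∃ V : Fin 3 → Fin 4 → ℂ, ∀ i j, G i j = ∑ k, V k i * V k j := by
  have hS : LinearMap.IsSymm (Matrix.toBilin' G) := by
    constructor
    intro x y
    simp only [Matrix.toBilin'_apply, RingHom.id_apply]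
    rw [Finset.sum_comm]
    refine Finset.sum_congr rfl fun i _ => Finset.sum_congr rfl fun j _ => ?_
    rw [hG.apply]
    ring
  obtain ⟨v0, hv0⟩ := LinearMap.BilinForm.exists_orthogonal_basis hS
  have hf : Module.finrank ℂ (Fin 4 → ℂ) = 4 := by simp
  let v : Module.Basis (Fin 4) ℂ (Fin 4 → ℂ) := v0.reindex (finCongr hf)
  have hv : ∀ i j, i ≠ j → Matrix.toBilin' G (v i) (v j) = 0 := by
    intro i j hij
    simp only [v, Module.Basis.reindex_apply]
    exact hv0 (by simpa using hij)
  have hex : ∃ k, Matrix.toBilin' G (v k) (v k) = 0 := by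
    obtain ⟨w, hw, hGw⟩ := Matrix.exists_mulVec_eq_zero_iff.mpr hdet
    have hr : v.repr w ≠ 0 := by simpa using hw
    obtain ⟨k, hk⟩ := Finsupp.ne_iff.mp hr
    refine ⟨k, ?_⟩
    have h1 : Matrix.toBilin' G (v k) w = 0 := by
      rw [Matrix.toBilin'_apply', hGw, dotProduct_zero]
    rw [← v.sum_repr w, map_sum, Finset.sum_eq_single k] at h1
    · rw [map_smul, smul_eq_mul] at h1
      exact (mul_eq_zero.mp h1).resolve_left hk
    · intro j _ hj
      rw [map_smul, hv k j hj.symm, smul_zero]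
    · simp
  obtain ⟨k0, hk0⟩ := hex
  have hsq : ∀ k, ∃ r : ℂ, Matrix.toBilin' G (v k) (v k) = r ^ 2 := fun k =>
    ⟨_, (Complex.cpow_nat_inv_pow _ two_ne_zero).symm⟩
  choose r hr using hsq
  have hrk : r k0 = 0 := by
    have := hr k0
    rw [hk0] at this
    exact pow_eq_zero_iff (two_ne_zero) |>.mp this.symm
  have key : ∀ x y, Matrix.toBilin' G x y =
      ∑ k, (r k * v.repr x k) * (r k * v.repr y k) := by
    intro x y
    conv_lhs => rw [← v.sum_repr x, ← v.sum_repr y]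
    rw [map_sum]
    refine Finset.sum_congr rfl fun i _ => ?_
    rw [map_smul, map_sum, LinearMap.sum_apply, Finset.sum_eq_single i]
    · rw [map_smul, LinearMap.smul_apply, smul_eq_mul, smul_eq_mul, hr i]
      ring
    · intro j _ hj
      rw [map_smul, LinearMap.smul_apply, hv j i hj]
      simp
    · simp
  refine ⟨fun k i => r (k0.succAbove k) * v.repr (Pi.single i 1) (k0.succAbove k), fun i j => ?_⟩
  have h := key (Pi.single i 1) (Pi.single j 1)
  rw [Matrix.toBilin'_single] at h
  rw [h, Fin.sum_univ_succAbove _ k0, hrk]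
  simp

/-- The twelve parameters generating `R`. -/
noncomputable def gens : Fin 12 → ((Fin 4 → M2) → ℂ) :=
  ![tfun 0, tfun 1, tfun 2, tfun 3, sfun 0 0, sfun 1 1, sfun 2 2, sfun 3 3,
     sfun 0 1, sfun 1 2, sfun 2 3, sfun 0 3]

/-- The parameter vector of a quadruple. -/
noncomputable def par (x : Fin 4 → M2) : Fin 12 → ℂ := fun i => gens i x

/-- The Gram determinant in terms of the parameters. -/
noncomputable def qdet (y : Fin 12 → ℂ) (a b : ℂ) : ℂ :=
  a ^ 2 * b ^ 2 - y 5 * y 7 * a ^ 2 - y 4 * y 6 * b ^ 2 - 2 * (y 8 * y 10 + y 9 * y 11) * (a * b)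
    + 2 * (y 8 * y 9 * y 7 + y 10 * y 11 * y 5) * a + 2 * (y 8 * y 11 * y 6 + y 9 * y 10 * y 4) * b
    + (y 4 * y 5 * y 6 * y 7 - y 8 ^ 2 * y 6 * y 7 - y 11 ^ 2 * y 5 * y 6 - y 9 ^ 2 * y 4 * y 7
      - y 10 ^ 2 * y 4 * y 5 + y 8 ^ 2 * y 10 ^ 2 + y 11 ^ 2 * y 9 ^ 2
      - 2 * (y 8 * y 9 * y 10 * y 11))

/-- Traceless matrix with Pauli coordinates, plus a scalar. -/
noncomputable def pauli (t α β γ : ℂ) : M2 :=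
  !![t / 2 + α, β - Complex.I * γ; β + Complex.I * γ, t / 2 - α]

lemma realize (y : Fin 12 → ℂ) (a b : ℂ) (h : qdet y a b = 0) :
    ∃ x, par x = y ∧ sfun 0 2 x = a ∧ sfun 1 3 x = b := by
  let G : Matrix (Fin 4) (Fin 4) ℂ :=
    !![y 4, y 8, a, y 11; y 8, y 5, y 9, b; a, y 9, y 6, y 10; y 11, b, y 10, y 7]
  have hs : G.IsSymm := by
    ext i j
    fin_cases i <;> fin_cases j <;> rfl
  have hd : G.det = 0 := by
    rw [← h]
    simp [G, Matrix.det_succ_row_zero, Fin.sum_univ_succ, qdet, Fin.succAbove]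
    ring
  have hd2 : ((2 : ℂ)⁻¹ • G).det = 0 := by
    rw [Matrix.det_smul, hd, mul_zero]
  obtain ⟨V, hV⟩ := exists_gram ((2 : ℂ)⁻¹ • G) (hs.smul _) hd2
  let x : Fin 4 → M2 := fun i => pauli (![y 0, y 1, y 2, y 3] i) (V 0 i) (V 1 i) (V 2 i)
  have hx : ∀ i j, sfun i j x = G i j := by
    intro i j
    have := hV i j
    rw [Fin.sum_univ_three, Matrix.smul_apply, smul_eq_mul] at this
    rw [sfun_eq]
    simp only [x, pauli, Matrix.of_apply, Matrix.cons_val', Matrix.cons_val_zero,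
      Matrix.cons_val_one, Matrix.cons_val_fin_one]
    linear_combination (-2 * V 2 i * V 2 j) * Complex.I_sq - 2 * this
  have ht : ∀ i, tfun i x = ![y 0, y 1, y 2, y 3] i := by
    intro i
    simp only [tfun, x, pauli, Matrix.trace_fin_two, Matrix.of_apply, Matrix.cons_val',
      Matrix.cons_val_zero, Matrix.cons_val_one, Matrix.cons_val_fin_one]
    ring
  refine ⟨x, ?_, hx 0 2, hx 1 3⟩
  ext i
  fin_cases i
  exacts [ht 0, ht 1, ht 2, ht 3, hx 0 0, hx 1 1, hx 2 2, hx 3 3, hx 0 1, hx 1 2, hx 2 3, hx 0 3]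

/-! ### Asymptotics -/

open Filter Topology in
/-- A continuous branch of the root of a quadratic equation. -/
lemma quad_branch (A B C : ℂ → ℂ) (β : ℂ) (hβ : β ≠ 0)
    (hA : Tendsto A (𝓝[≠] 0) (𝓝 1)) (hB : Tendsto B (𝓝[≠] 0) (𝓝 0))
    (hC : Tendsto C (𝓝[≠] 0) (𝓝 (-β ^ 2))) :
    ∃ b : ℂ → ℂ, Tendsto b (𝓝[≠] 0) (𝓝 β) ∧
      ∀ᶠ ε in 𝓝[≠] (0 : ℂ), A ε * b ε ^ 2 + B ε * b ε + C ε = 0 := by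
  let D : ℂ → ℂ := fun ε => (B ε ^ 2 - 4 * A ε * C ε) / (4 * β ^ 2)
  let S : ℂ → ℂ := fun ε => D ε ^ (((2 : ℕ) : ℂ)⁻¹)
  have hD : Tendsto D (𝓝[≠] 0) (𝓝 1) := by
    have h1 : Tendsto D (𝓝[≠] 0) (𝓝 ((0 ^ 2 - 4 * 1 * (-β ^ 2)) / (4 * β ^ 2))) :=
      ((hB.pow 2).sub ((hA.const_mul 4).mul hC)).div_const _
    have h2 : ((0 : ℂ) ^ 2 - 4 * 1 * (-β ^ 2)) / (4 * β ^ 2) = 1 := by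
      field_simp
      ring
    rwa [h2] at h1
  have hS : Tendsto S (𝓝[≠] 0) (𝓝 1) := by
    have h1 : ContinuousAt (fun z : ℂ => z ^ (((2 : ℕ) : ℂ)⁻¹)) 1 :=
      continuousAt_cpow_const (by simp)
    have h2 := h1.tendsto.comp hD
    rwa [Complex.one_cpow] at h2
  have hS2 : ∀ ε, S ε ^ 2 = D ε := fun ε => Complex.cpow_nat_inv_pow _ two_ne_zero
  refine ⟨fun ε => (-B ε + 2 * β * S ε) / (2 * A ε), ?_, ?_⟩
  · have h1 := ((hB.neg).add (hS.const_mul (2 * β))).div (hA.const_mul 2) (by norm_num)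
    have h2 : (-0 + 2 * β * 1) / (2 * 1) = β := by ring
    rwa [h2] at h1
  · filter_upwards [hA.eventually_ne one_ne_zero] with ε hε
    have h3 : 4 * β ^ 2 * S ε ^ 2 = B ε ^ 2 - 4 * A ε * C ε := by
      rw [hS2]
      simp only [D]
      field_simp
    field_simp
    linear_combination h3

open Filter Topology in
/-- Over every parameter vector with `s₂₂ s₄₄ ≠ 0` there is a family of quadruples with
`s₁₃ = 1/ε → ∞` and `s₂₄` tending to a given square root of `s₂₂ s₄₄`. -/
lemma branch (y : Fin 12 → ℂ) (β : ℂ) (hβ : β ^ 2 = y 5 * y 7) (h0 : β ≠ 0) :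
    ∃ X : ℂ → (Fin 4 → M2),
      (∀ᶠ ε in 𝓝[≠] (0 : ℂ), ε ≠ 0 ∧ par (X ε) = y ∧ sfun 0 2 (X ε) = ε⁻¹) ∧
      Tendsto (fun ε => sfun 1 3 (X ε)) (𝓝[≠] 0) (𝓝 β) := by
  let A : ℂ → ℂ := fun ε => 1 - y 4 * y 6 * ε ^ 2
  let B : ℂ → ℂ := fun ε => -2 * (y 8 * y 10 + y 9 * y 11) * ε
    + 2 * (y 8 * y 11 * y 6 + y 9 * y 10 * y 4) * ε ^ 2
  let C : ℂ → ℂ := fun ε => -(y 5 * y 7) + 2 * (y 8 * y 9 * y 7 + y 10 * y 11 * y 5) * ε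
    + (y 4 * y 5 * y 6 * y 7 - y 8 ^ 2 * y 6 * y 7 - y 11 ^ 2 * y 5 * y 6 - y 9 ^ 2 * y 4 * y 7
      - y 10 ^ 2 * y 4 * y 5 + y 8 ^ 2 * y 10 ^ 2 + y 11 ^ 2 * y 9 ^ 2
      - 2 * (y 8 * y 9 * y 10 * y 11)) * ε ^ 2
  have hA : Tendsto A (𝓝[≠] 0) (𝓝 1) := by
    have : ContinuousAt A 0 := by fun_prop
    have h := this.tendsto.mono_left (nhdsWithin_le_nhds (s := {0}ᶜ))
    simpa [A] using h
  have hB : Tendsto B (𝓝[≠] 0) (𝓝 0) := by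
    have : ContinuousAt B 0 := by fun_prop
    have h := this.tendsto.mono_left (nhdsWithin_le_nhds (s := {0}ᶜ))
    simpa [B] using h
  have hC : Tendsto C (𝓝[≠] 0) (𝓝 (-β ^ 2)) := by
    have : ContinuousAt C 0 := by fun_prop
    have h := this.tendsto.mono_left (nhdsWithin_le_nhds (s := {0}ᶜ))
    rw [hβ]
    simpa [C] using h
  obtain ⟨b, hb, hq⟩ := quad_branch A B C β h0 hA hB hC
  have hex : ∀ ε, ∃ x, (ε ≠ 0 ∧ A ε * b ε ^ 2 + B ε * b ε + C ε = 0) →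
      par x = y ∧ sfun 0 2 x = ε⁻¹ ∧ sfun 1 3 x = b ε := by
    intro ε
    by_cases h : ε ≠ 0 ∧ A ε * b ε ^ 2 + B ε * b ε + C ε = 0
    · obtain ⟨hε, hq⟩ := h
      have hqd : qdet y ε⁻¹ (b ε) = 0 := by
        have e : qdet y ε⁻¹ (b ε) = (ε⁻¹) ^ 2 * (A ε * b ε ^ 2 + B ε * b ε + C ε) := by
          simp only [qdet, A, B, C]
          field_simp
          ring
        rw [e, hq, mul_zero]
      obtain ⟨x, hx⟩ := realize y _ _ hqd
      exact ⟨x, fun _ => hx⟩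
    · exact ⟨0, fun h' => absurd h' h⟩
  choose X hX using hex
  have hev : ∀ᶠ ε in 𝓝[≠] (0 : ℂ), ε ≠ 0 ∧ A ε * b ε ^ 2 + B ε * b ε + C ε = 0 :=
    (eventually_mem_nhdsWithin).and hq
  refine ⟨X, ?_, ?_⟩
  · filter_upwards [hev] with ε hε
    exact ⟨hε.1, (hX ε hε).1, (hX ε hε).2.1⟩
  · refine hb.congr' ?_
    filter_upwards [hev] with ε hε
    exact (hX ε hε).2.2.symm

open Filter Topology in
lemma topcoef (N : ℕ) (α β : ℕ → ℂ) (A B C : ℂ → ℂ) (A0 B0 : ℂ)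
    (hA : Tendsto A (𝓝[≠] 0) (𝓝 A0)) (hB : Tendsto B (𝓝[≠] 0) (𝓝 B0))
    (hC : Tendsto C (𝓝[≠] 0) (𝓝 0))
    (h : ∀ᶠ ε in 𝓝[≠] (0 : ℂ), ∑ k ∈ Finset.range (N + 1),
      (ε⁻¹) ^ k * (α k * A ε + β k * B ε) + C ε = 0) : α N * A0 + β N * B0 = 0 := by
  have hid : Tendsto (fun ε : ℂ => ε) (𝓝[≠] 0) (𝓝 0) :=
    tendsto_id.mono_left nhdsWithin_le_nhds
  have hF : ∀ k, Tendsto (fun ε => α k * A ε + β k * B ε) (𝓝[≠] 0) (𝓝 (α k * A0 + β k * B0)) :=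
    fun k => (hA.const_mul _).add (hB.const_mul _)
  have hlim : Tendsto (fun ε => ∑ k ∈ Finset.range N, ε ^ (N - k) * (α k * A ε + β k * B ε)
      + (α N * A ε + β N * B ε) + ε ^ N * C ε) (𝓝[≠] 0)
      (𝓝 (∑ k ∈ Finset.range N, 0 ^ (N - k) * (α k * A0 + β k * B0)
        + (α N * A0 + β N * B0) + 0 ^ N * 0)) :=
    ((tendsto_finsetSum _ fun k _ => (hid.pow _).mul (hF k)).add (hF N)).add
      ((hid.pow N).mul hC)
  have hz : ∑ k ∈ Finset.range N, (0 : ℂ) ^ (N - k) * (α k * A0 + β k * B0) = 0 := by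
    refine Finset.sum_eq_zero fun k hk => ?_
    have := Finset.mem_range.mp hk
    rw [zero_pow (by omega), zero_mul]
  rw [hz, zero_add, mul_zero, add_zero] at hlim
  refine tendsto_nhds_unique hlim (tendsto_const_nhds.congr' ?_)
  filter_upwards [h, eventually_mem_nhdsWithin] with ε hε hne
  have hne : ε ≠ 0 := hne
  rw [Finset.sum_range_succ] at hε
  have e1 : ∑ k ∈ Finset.range N, ε ^ (N - k) * (α k * A ε + β k * B ε)
      = ε ^ N * ∑ k ∈ Finset.range N, (ε⁻¹) ^ k * (α k * A ε + β k * B ε) := by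
    rw [Finset.mul_sum]
    refine Finset.sum_congr rfl fun k hk => ?_
    have hk := Finset.mem_range.mp hk
    rw [← mul_assoc, inv_pow, pow_sub₀ _ hne hk.le]
  have e2 : ε ^ N * (ε⁻¹) ^ N = 1 := by rw [← mul_pow, mul_inv_cancel₀ hne, one_pow]
  rw [e1]
  linear_combination -(ε ^ N) * hε + (α N * A ε + β N * B ε) * e2

open Filter Topology in
lemma allcoef (N : ℕ) (α β : ℕ → ℂ) (A B C A' B' C' : ℂ → ℂ) (A0 B0 A0' B0' : ℂ)
    (hA : Tendsto A (𝓝[≠] 0) (𝓝 A0)) (hB : Tendsto B (𝓝[≠] 0) (𝓝 B0))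
    (hC : Tendsto C (𝓝[≠] 0) (𝓝 0))
    (hA' : Tendsto A' (𝓝[≠] 0) (𝓝 A0')) (hB' : Tendsto B' (𝓝[≠] 0) (𝓝 B0'))
    (hC' : Tendsto C' (𝓝[≠] 0) (𝓝 0))
    (hdet : A0 * B0' - A0' * B0 ≠ 0)
    (h : ∀ᶠ ε in 𝓝[≠] (0 : ℂ), ∑ k ∈ Finset.range N,
      (ε⁻¹) ^ k * (α k * A ε + β k * B ε) + C ε = 0)
    (h' : ∀ᶠ ε in 𝓝[≠] (0 : ℂ), ∑ k ∈ Finset.range N,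
      (ε⁻¹) ^ k * (α k * A' ε + β k * B' ε) + C' ε = 0) :
    ∀ k < N, α k = 0 ∧ β k = 0 := by
  induction N with
  | zero => intro k hk; omega
  | succ N ih =>
    have t := topcoef N α β A B C A0 B0 hA hB hC h
    have t' := topcoef N α β A' B' C' A0' B0' hA' hB' hC' h'
    have hα : α N = 0 := by
      have : α N * (A0 * B0' - A0' * B0) = 0 := by linear_combination B0' * t - B0 * t'
      exact (mul_eq_zero.mp this).resolve_right hdet
    have hβ : β N = 0 := by
      have : β N * (A0 * B0' - A0' * B0) = 0 := by linear_combination A0 * t' - A0' * t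
      exact (mul_eq_zero.mp this).resolve_right hdet
    simp only [Finset.sum_range_succ, hα, hβ, zero_mul, add_zero, mul_zero] at h h'
    intro k hk
    rcases Nat.lt_succ_iff_lt_or_eq.mp hk with hk | rfl
    · exact ih h h' k hk
    · exact ⟨hα, hβ⟩

/-! ### Vanishing of coefficients over a fixed parameter vector -/

lemma par_vals (x : Fin 4 → M2) :
    par x 0 = tfun 0 x ∧ par x 1 = tfun 1 x ∧ par x 2 = tfun 2 x ∧ par x 3 = tfun 3 x ∧
    par x 4 = sfun 0 0 x ∧ par x 5 = sfun 1 1 x ∧ par x 6 = sfun 2 2 x ∧ par x 7 = sfun 3 3 x ∧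
    par x 8 = sfun 0 1 x ∧ par x 9 = sfun 1 2 x ∧ par x 10 = sfun 2 3 x ∧ par x 11 = sfun 0 3 x :=
  ⟨rfl, rfl, rfl, rfl, rfl, rfl, rfl, rfl, rfl, rfl, rfl, rfl⟩

lemma odd_prods (x : Fin 4 → M2) (y : Fin 12 → ℂ) (hy : par x = y) (a b : ℂ)
    (ha : sfun 0 2 x = a) (hb : sfun 1 3 x = b) :
    sfun3 0 1 2 x * sfun3 0 1 2 x = (-1 / 2) * (y 4 * y 5 * y 6 + 2 * y 8 * y 9 * a
      - y 4 * y 9 ^ 2 - y 5 * a ^ 2 - y 6 * y 8 ^ 2) ∧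
    sfun3 0 1 2 x * sfun3 0 2 3 x = (-1 / 2) * (y 4 * (y 9 * y 10 - b * y 6)
      - a * (y 8 * y 10 - b * a) + y 11 * (y 8 * y 6 - y 9 * a)) ∧
    sfun3 0 1 2 x * sfun3 0 1 3 x = (-1 / 2) * (y 4 * (y 5 * y 10 - b * y 9)
      - y 8 * (y 8 * y 10 - a * b) + y 11 * (y 8 * y 9 - y 5 * a)) ∧
    sfun3 0 1 2 x * sfun3 1 2 3 x = (-1 / 2) * (y 8 * (y 9 * y 10 - b * y 6)
      - a * (y 5 * y 10 - b * y 9) + y 11 * (y 5 * y 6 - y 9 ^ 2)) := by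
  subst hy ha hb
  obtain ⟨-, -, -, -, h4, h5, h6, h7, h8, h9, h10, h11⟩ := par_vals x
  rw [h4, h5, h6, h8, h9, h10, h11]
  simp only [sfun_eq, sfun3_eq]
  refine ⟨?_, ?_, ?_, ?_⟩ <;> ring

open Filter Topology in
lemma tendsto_id0 : Tendsto (fun ε : ℂ => ε) (𝓝[≠] 0) (𝓝 0) :=
    tendsto_id.mono_left nhdsWithin_le_nhds

open Filter Topology in
/-- If `F` is jointly continuous then it has the evident limit along a branch. -/
lemma tendsto_along (b : ℂ → ℂ) (β : ℂ) (hb : Tendsto b (𝓝[≠] 0) (𝓝 β)) (F : ℂ × ℂ → ℂ)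
    (hF : Continuous F) : Tendsto (fun ε => F (ε, b ε)) (𝓝[≠] 0) (𝓝 (F (0, β))) :=
  (hF.tendsto (0, β)).comp (tendsto_id0.prodMk_nhds hb)

lemma exists_sqrt (y : Fin 12 → ℂ) (hy : y 5 * y 7 ≠ 0) : ∃ β : ℂ, β ^ 2 = y 5 * y 7 ∧ β ≠ 0 := by
  refine ⟨_, Complex.cpow_nat_inv_pow (y 5 * y 7) two_ne_zero, ?_⟩
  intro h
  apply hy
  rw [← Complex.cpow_nat_inv_pow (y 5 * y 7) two_ne_zero, h]
  simp

lemma half_even (y : Fin 12 → ℂ) (hy : y 5 * y 7 ≠ 0) (N : ℕ) (c d : ℕ → ℂ) (P Q : ℂ → ℂ)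
    (hP : Continuous P) (hQ : Continuous Q)
    (h : ∀ x, par x = y → ∑ k ∈ Finset.range N, sfun 0 2 x ^ (k + 2) * (c k + d k * sfun 1 3 x)
      + P (sfun 1 3 x) + sfun 0 2 x * Q (sfun 1 3 x) = 0) :
    ∀ k < N, c k = 0 ∧ d k = 0 := by
  obtain ⟨β, hβ, h0⟩ := exists_sqrt y hy
  obtain ⟨X, hX, hb⟩ := branch y β hβ h0
  obtain ⟨X', hX', hb'⟩ := branch y (-β) (by rw [neg_sq, hβ]) (neg_ne_zero.mpr h0)
  refine allcoef N c d (fun _ => 1) (fun ε => sfun 1 3 (X ε))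
    (fun ε => ε ^ 2 * P (sfun 1 3 (X ε)) + ε * Q (sfun 1 3 (X ε))) (fun _ => 1)
    (fun ε => sfun 1 3 (X' ε))
    (fun ε => ε ^ 2 * P (sfun 1 3 (X' ε)) + ε * Q (sfun 1 3 (X' ε))) 1 β 1 (-β)
    tendsto_const_nhds hb ?_ tendsto_const_nhds hb' ?_ ?_ ?_ ?_
  · have t := tendsto_along _ β hb (fun p => p.1 ^ 2 * P p.2 + p.1 * Q p.2) (by fun_prop)
    have e : (0 : ℂ) ^ 2 * P β + 0 * Q β = 0 := by ring
    simp only [e] at t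
    exact t
  · have t := tendsto_along _ (-β) hb' (fun p => p.1 ^ 2 * P p.2 + p.1 * Q p.2) (by fun_prop)
    have e : (0 : ℂ) ^ 2 * P (-β) + 0 * Q (-β) = 0 := by ring
    simp only [e] at t
    exact t
  · intro h2
    apply h0
    linear_combination (-1 / 2) * h2
  · filter_upwards [hX] with ε ⟨hε, hp, ha⟩
    have h1 := h _ hp
    rw [ha] at h1
    have e : ∑ k ∈ Finset.range N, (ε⁻¹) ^ (k + 2) * (c k + d k * sfun 1 3 (X ε))
        = (ε⁻¹) ^ 2 * ∑ k ∈ Finset.range N, (ε⁻¹) ^ k * (c k * 1 + d k * sfun 1 3 (X ε)) := by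
      rw [Finset.mul_sum]
      refine Finset.sum_congr rfl fun k _ => ?_
      ring
    rw [e] at h1
    have h2 : ε * ε⁻¹ = 1 := mul_inv_cancel₀ hε
    linear_combination ε ^ 2 * h1 + (-(ε * ε⁻¹ + 1) * (∑ k ∈ Finset.range N, (ε⁻¹) ^ k *
      (c k * 1 + d k * sfun 1 3 (X ε))) - ε * Q (sfun 1 3 (X ε))) * h2
  · filter_upwards [hX'] with ε ⟨hε, hp, ha⟩
    have h1 := h _ hp
    rw [ha] at h1
    have e : ∑ k ∈ Finset.range N, (ε⁻¹) ^ (k + 2) * (c k + d k * sfun 1 3 (X' ε))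
        = (ε⁻¹) ^ 2 * ∑ k ∈ Finset.range N, (ε⁻¹) ^ k * (c k * 1 + d k * sfun 1 3 (X' ε)) := by
      rw [Finset.mul_sum]
      refine Finset.sum_congr rfl fun k _ => ?_
      ring
    rw [e] at h1
    have h2 : ε * ε⁻¹ = 1 := mul_inv_cancel₀ hε
    linear_combination ε ^ 2 * h1 + (-(ε * ε⁻¹ + 1) * (∑ k ∈ Finset.range N, (ε⁻¹) ^ k *
      (c k * 1 + d k * sfun 1 3 (X' ε))) - ε * Q (sfun 1 3 (X' ε))) * h2

lemma low_even (y : Fin 12 → ℂ) (hy : y 5 * y 7 ≠ 0) (c d : ℕ → ℂ)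
    (h : ∀ x, par x = y → ∑ k ∈ Finset.range 2, sfun 0 2 x ^ k * (c k + d k * sfun 1 3 x) = 0) :
    ∀ k < 2, c k = 0 ∧ d k = 0 := by
  obtain ⟨β, hβ, h0⟩ := exists_sqrt y hy
  obtain ⟨X, hX, hb⟩ := branch y β hβ h0
  obtain ⟨X', hX', hb'⟩ := branch y (-β) (by rw [neg_sq, hβ]) (neg_ne_zero.mpr h0)
  refine allcoef 2 c d (fun _ => 1) (fun ε => sfun 1 3 (X ε)) (fun _ => 0) (fun _ => 1)
    (fun ε => sfun 1 3 (X' ε)) (fun _ => 0) 1 β 1 (-β)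
    tendsto_const_nhds hb tendsto_const_nhds tendsto_const_nhds hb' tendsto_const_nhds ?_ ?_ ?_
  · intro h2
    apply h0
    linear_combination (-1 / 2) * h2
  · filter_upwards [hX] with ε ⟨hε, hp, ha⟩
    have h1 := h _ hp
    rw [ha] at h1
    simpa using h1
  · filter_upwards [hX'] with ε ⟨hε, hp, ha⟩
    have h1 := h _ hp
    rw [ha] at h1
    simpa using h1

open Filter Topology in
/-- The data along one branch needed for the odd part. -/
lemma odd_branch (y : Fin 12 → ℂ) (N : ℕ) (α γ : ℕ → ℂ) (P Q : ℂ → ℂ)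
    (hP : Continuous P) (hQ : Continuous Q)
    (h : ∀ x, par x = y → ∑ k ∈ Finset.range N, sfun 0 2 x ^ k *
        (α k * sfun3 0 1 2 x + γ k * sfun3 0 2 3 x)
      + P (sfun 1 3 x) * sfun3 0 1 3 x + Q (sfun 1 3 x) * sfun3 1 2 3 x = 0)
    (β : ℂ) (hβ : β ^ 2 = y 5 * y 7) (h0 : β ≠ 0) :
    ∃ A B C : ℂ → ℂ, Tendsto A (𝓝[≠] 0) (𝓝 (y 5 / 2)) ∧ Tendsto B (𝓝[≠] 0) (𝓝 (-β / 2)) ∧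
      Tendsto C (𝓝[≠] 0) (𝓝 0) ∧
      ∀ᶠ ε in 𝓝[≠] (0 : ℂ), ∑ k ∈ Finset.range N,
      (ε⁻¹) ^ k * (α k * A ε + γ k * B ε) + C ε = 0 := by
  obtain ⟨X, hX, hb⟩ := branch y β hβ h0
  refine ⟨fun ε => ε ^ 2 * (sfun3 0 1 2 (X ε) * sfun3 0 1 2 (X ε)),
    fun ε => ε ^ 2 * (sfun3 0 1 2 (X ε) * sfun3 0 2 3 (X ε)),
    fun ε => ε ^ 2 * (P (sfun 1 3 (X ε)) * (sfun3 0 1 2 (X ε) * sfun3 0 1 3 (X ε))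
      + Q (sfun 1 3 (X ε)) * (sfun3 0 1 2 (X ε) * sfun3 1 2 3 (X ε))), ?_, ?_, ?_, ?_⟩
  · have t := tendsto_along _ β hb (fun p => (-1 / 2) * (p.1 ^ 2 * (y 4 * y 5 * y 6
      - y 4 * y 9 ^ 2 - y 6 * y 8 ^ 2) + 2 * y 8 * y 9 * p.1 - y 5)) (by fun_prop)
    have e : (-1 / 2 : ℂ) * ((0 : ℂ) ^ 2 * (y 4 * y 5 * y 6
      - y 4 * y 9 ^ 2 - y 6 * y 8 ^ 2) + 2 * y 8 * y 9 * 0 - y 5) = y 5 / 2 := by ring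
    simp only [e] at t
    refine t.congr' ?_
    filter_upwards [hX] with ε ⟨hε, hp, ha⟩
    rw [(odd_prods (X ε) y hp ε⁻¹ _ ha rfl).1]
    field_simp
    ring
  · have t := tendsto_along _ β hb (fun p => (-1 / 2) * (p.1 ^ 2 * (y 4 * y 9 * y 10
      + y 11 * y 8 * y 6) - p.1 ^ 2 * p.2 * (y 4 * y 6) - p.1 * (y 8 * y 10 + y 9 * y 11) + p.2))
      (by fun_prop)
    have e : (-1 / 2 : ℂ) * ((0 : ℂ) ^ 2 * (y 4 * y 9 * y 10
      + y 11 * y 8 * y 6) - (0 : ℂ) ^ 2 * β * (y 4 * y 6) - 0 * (y 8 * y 10 + y 9 * y 11) + β)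
      = -β / 2 := by ring
    simp only [e] at t
    refine t.congr' ?_
    filter_upwards [hX] with ε ⟨hε, hp, ha⟩
    rw [(odd_prods (X ε) y hp ε⁻¹ _ ha rfl).2.1]
    field_simp
    ring
  · have t := tendsto_along _ β hb (fun p =>
      P p.2 * ((-1 / 2) * (p.1 ^ 2 * (y 4 * (y 5 * y 10 - p.2 * y 9)
        - y 8 * (y 8 * y 10) + y 11 * (y 8 * y 9)) + p.1 * (y 8 * p.2 - y 11 * y 5)))
      + Q p.2 * ((-1 / 2) * (p.1 ^ 2 * (y 8 * (y 9 * y 10 - p.2 * y 6)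
        + y 11 * (y 5 * y 6 - y 9 ^ 2)) - p.1 * (y 5 * y 10 - p.2 * y 9))))
      (by fun_prop)
    have e : P β * ((-1 / 2) * ((0 : ℂ) ^ 2 * (y 4 * (y 5 * y 10 - β * y 9)
        - y 8 * (y 8 * y 10) + y 11 * (y 8 * y 9)) + 0 * (y 8 * β - y 11 * y 5)))
      + Q β * ((-1 / 2) * ((0 : ℂ) ^ 2 * (y 8 * (y 9 * y 10 - β * y 6)
        + y 11 * (y 5 * y 6 - y 9 ^ 2)) - 0 * (y 5 * y 10 - β * y 9))) = 0 := by ring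
    simp only [e] at t
    refine t.congr' ?_
    filter_upwards [hX] with ε ⟨hε, hp, ha⟩
    rw [(odd_prods (X ε) y hp ε⁻¹ _ ha rfl).2.2.1, (odd_prods (X ε) y hp ε⁻¹ _ ha rfl).2.2.2]
    field_simp
    ring
  · filter_upwards [hX] with ε ⟨hε, hp, ha⟩
    have h1 := h _ hp
    rw [ha] at h1
    have e : ∑ k ∈ Finset.range N, (ε⁻¹) ^ k *
        (α k * (ε ^ 2 * (sfun3 0 1 2 (X ε) * sfun3 0 1 2 (X ε)))
          + γ k * (ε ^ 2 * (sfun3 0 1 2 (X ε) * sfun3 0 2 3 (X ε))))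
        = (ε ^ 2 * sfun3 0 1 2 (X ε)) * ∑ k ∈ Finset.range N, (ε⁻¹) ^ k *
          (α k * sfun3 0 1 2 (X ε) + γ k * sfun3 0 2 3 (X ε)) := by
      rw [Finset.mul_sum]
      refine Finset.sum_congr rfl fun k _ => ?_
      ring
    rw [e]
    linear_combination (ε ^ 2 * sfun3 0 1 2 (X ε)) * h1

lemma half_odd (y : Fin 12 → ℂ) (hy : y 5 * y 7 ≠ 0) (N : ℕ) (α γ : ℕ → ℂ) (P Q : ℂ → ℂ)
    (hP : Continuous P) (hQ : Continuous Q)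
    (h : ∀ x, par x = y → ∑ k ∈ Finset.range N, sfun 0 2 x ^ k *
        (α k * sfun3 0 1 2 x + γ k * sfun3 0 2 3 x)
      + P (sfun 1 3 x) * sfun3 0 1 3 x + Q (sfun 1 3 x) * sfun3 1 2 3 x = 0) :
    ∀ k < N, α k = 0 ∧ γ k = 0 := by
  obtain ⟨β, hβ, h0⟩ := exists_sqrt y hy
  obtain ⟨A, B, C, hA, hB, hC, hs⟩ := odd_branch y N α γ P Q hP hQ h β hβ h0
  obtain ⟨A', B', C', hA', hB', hC', hs'⟩ := odd_branch y N α γ P Q hP hQ h (-β)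
    (by rw [neg_sq, hβ]) (neg_ne_zero.mpr h0)
  refine allcoef N α γ A B C A' B' C' _ _ _ _ hA hB hC hA' hB' hC' ?_ hs hs'
  intro h2
  have h3 : y 5 * β = 0 := by linear_combination 2 * h2
  exact (mul_ne_zero (left_ne_zero_of_mul hy) h0) h3

/-- Cyclic shift of a quadruple. -/
def shiftx (x : Fin 4 → M2) : Fin 4 → M2 := ![x 3, x 0, x 1, x 2]

/-- The corresponding permutation of the parameters. -/
def shifty (y : Fin 12 → ℂ) : Fin 12 → ℂ :=
  ![y 1, y 2, y 3, y 0, y 5, y 6, y 7, y 4, y 9, y 10, y 11, y 8]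

lemma par_shift (y : Fin 12 → ℂ) (x : Fin 4 → M2) (h : par x = shifty y) :
    par (shiftx x) = y := by
  have e : ∀ i, par x i = shifty y i := fun i => congrFun h i
  ext i
  fin_cases i
  · exact e 3
  · exact e 0
  · exact e 1
  · exact e 2
  · exact e 7
  · exact e 4
  · exact e 5
  · exact e 6
  · exact (congrFun (sfun_symm 3 0) x).trans (e 11)
  · exact e 8
  · exact e 9
  · exact (congrFun (sfun_symm 3 2) x).trans (e 10)

lemma shift_vals (x : Fin 4 → M2) :
    sfun 0 2 (shiftx x) = sfun 1 3 x ∧ sfun 1 3 (shiftx x) = sfun 0 2 x ∧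
    sfun3 0 1 2 (shiftx x) = sfun3 0 1 3 x ∧ sfun3 0 2 3 (shiftx x) = sfun3 1 2 3 x ∧
    sfun3 0 1 3 (shiftx x) = sfun3 0 2 3 x ∧ sfun3 1 2 3 (shiftx x) = sfun3 0 1 2 x :=
  ⟨congrFun (sfun_symm 3 1) x, rfl, congrFun (sfun3_cyc 3 0 1) x, congrFun (sfun3_cyc 3 1 2) x,
    congrFun (sfun3_cyc 3 0 2) x, rfl⟩

/-- The involution `x ↦ tr(x) - x`, which changes the sign of traceless parts. -/
noncomputable def flipx (x : Fin 4 → M2) : Fin 4 → M2 := fun i => (x i).trace • (1 : M2) - x i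

lemma flip_sfun (i j : Fin 4) (x : Fin 4 → M2) : sfun i j (flipx x) = sfun i j x := by
  simp only [sfun_eq]
  simp [flipx, Matrix.trace_fin_two]
  ring

lemma flip_sfun3 (i j k : Fin 4) (x : Fin 4 → M2) : sfun3 i j k (flipx x) = -sfun3 i j k x := by
  simp only [sfun3_eq]
  simp [flipx, Matrix.trace_fin_two]
  ring

lemma flip_tfun (i : Fin 4) (x : Fin 4 → M2) : tfun i (flipx x) = tfun i x := by
  simp [tfun, flipx, Matrix.trace_fin_two]
  ring

lemma par_flip (x : Fin 4 → M2) : par (flipx x) = par x := by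
  ext i
  fin_cases i
  exacts [flip_tfun 0 x, flip_tfun 1 x, flip_tfun 2 x, flip_tfun 3 x, flip_sfun 0 0 x,
    flip_sfun 1 1 x, flip_sfun 2 2 x, flip_sfun 3 3 x, flip_sfun 0 1 x, flip_sfun 1 2 x,
    flip_sfun 2 3 x, flip_sfun 0 3 x]

lemma split_one (N : ℕ) (X p q : ℕ → ℂ) (Y : ℂ) :
    ∑ k ∈ Finset.range N, X k * (p k + q k * Y)
      = ∑ k ∈ Finset.range N, X k * p k + (∑ k ∈ Finset.range N, X k * q k) * Y := by
  rw [Finset.sum_mul, ← Finset.sum_add_distrib]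
  exact Finset.sum_congr rfl fun k _ => by ring

lemma split_two (N : ℕ) (X p q : ℕ → ℂ) (Y Z : ℂ) :
    ∑ k ∈ Finset.range N, X k * (p k * Y + q k * Z)
      = (∑ k ∈ Finset.range N, X k * p k) * Y + (∑ k ∈ Finset.range N, X k * q k) * Z := by
  rw [Finset.sum_mul, Finset.sum_mul, ← Finset.sum_add_distrib]
  exact Finset.sum_congr rfl fun k _ => by ring

/-- All coefficients of a relation over a generic parameter vector vanish. -/
lemma core (y : Fin 12 → ℂ) (hy : y 5 * y 7 ≠ 0) (hy' : y 4 * y 6 ≠ 0) (N : ℕ) (g : Fin 4 → ℂ)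
    (c o : Fin 4 → ℕ → ℂ)
    (h : ∀ x, par x = y →
      (g 0 + g 1 * sfun 0 2 x + g 2 * sfun 1 3 x + g 3 * (sfun 0 2 x * sfun 1 3 x))
      + (∑ k ∈ Finset.range N, sfun 0 2 x ^ (k + 2) * (c 0 k + c 1 k * sfun 1 3 x)
        + ∑ k ∈ Finset.range N, sfun 1 3 x ^ (k + 2) * (c 2 k + c 3 k * sfun 0 2 x))
      + (∑ k ∈ Finset.range N, sfun 0 2 x ^ k * (o 0 k * sfun3 0 1 2 x + o 1 k * sfun3 0 2 3 x)
        + ∑ k ∈ Finset.range N, sfun 1 3 x ^ k * (o 2 k * sfun3 0 1 3 x + o 3 k * sfun3 1 2 3 x))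
      = 0) :
    (∀ i, g i = 0) ∧ (∀ i, ∀ k < N, c i k = 0) ∧ (∀ i, ∀ k < N, o i k = 0) := by
  have hsum : ∀ x, ∑ k ∈ Finset.range N, sfun 0 2 x ^ k *
      (o 0 k * -sfun3 0 1 2 x + o 1 k * -sfun3 0 2 3 x) = -∑ k ∈ Finset.range N, sfun 0 2 x ^ k *
      (o 0 k * sfun3 0 1 2 x + o 1 k * sfun3 0 2 3 x) := by
    intro x
    rw [← Finset.sum_neg_distrib]
    exact Finset.sum_congr rfl fun k _ => by ring
  have hsum' : ∀ x, ∑ k ∈ Finset.range N, sfun 1 3 x ^ k *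
      (o 2 k * -sfun3 0 1 3 x + o 3 k * -sfun3 1 2 3 x) = -∑ k ∈ Finset.range N, sfun 1 3 x ^ k *
      (o 2 k * sfun3 0 1 3 x + o 3 k * sfun3 1 2 3 x) := by
    intro x
    rw [← Finset.sum_neg_distrib]
    exact Finset.sum_congr rfl fun k _ => by ring
  have hflip := fun x (hx : par x = y) => h (flipx x) ((par_flip x).trans hx)
  simp only [flip_sfun, flip_sfun3, hsum, hsum'] at hflip
  have heven : ∀ x, par x = y →
      (g 0 + g 1 * sfun 0 2 x + g 2 * sfun 1 3 x + g 3 * (sfun 0 2 x * sfun 1 3 x))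
      + (∑ k ∈ Finset.range N, sfun 0 2 x ^ (k + 2) * (c 0 k + c 1 k * sfun 1 3 x)
        + ∑ k ∈ Finset.range N, sfun 1 3 x ^ (k + 2) * (c 2 k + c 3 k * sfun 0 2 x)) = 0 := by
    intro x hx
    linear_combination (1 / 2) * h x hx + (1 / 2) * hflip x hx
  have hodd : ∀ x, par x = y →
      (∑ k ∈ Finset.range N, sfun 0 2 x ^ k * (o 0 k * sfun3 0 1 2 x + o 1 k * sfun3 0 2 3 x)
        + ∑ k ∈ Finset.range N, sfun 1 3 x ^ k * (o 2 k * sfun3 0 1 3 x + o 3 k * sfun3 1 2 3 x))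
      = 0 := by
    intro x hx
    linear_combination (1 / 2) * h x hx - (1 / 2) * hflip x hx
  have hys : shifty y 5 * shifty y 7 ≠ 0 := by
    have : shifty y 5 * shifty y 7 = y 4 * y 6 := mul_comm _ _
    rwa [this]
  have hc01 := half_even y hy N (c 0) (c 1)
    (fun b => g 0 + g 2 * b + ∑ k ∈ Finset.range N, b ^ (k + 2) * c 2 k)
    (fun b => g 1 + g 3 * b + ∑ k ∈ Finset.range N, b ^ (k + 2) * c 3 k)
    (by fun_prop) (by fun_prop) (by
      intro x hx
      have := heven x hx
      have e := split_one N (fun k => sfun 1 3 x ^ (k + 2)) (c 2) (c 3) (sfun 0 2 x)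
      beta_reduce at e ⊢
      linear_combination this - e)
  have hc23 := half_even (shifty y) hys N (c 2) (c 3)
    (fun b => g 0 + g 1 * b + ∑ k ∈ Finset.range N, b ^ (k + 2) * c 0 k)
    (fun b => g 2 + g 3 * b + ∑ k ∈ Finset.range N, b ^ (k + 2) * c 1 k)
    (by fun_prop) (by fun_prop) (by
      intro x hx
      have := heven (shiftx x) (par_shift y x hx)
      obtain ⟨e1, e2, -⟩ := shift_vals x
      rw [e1, e2] at this
      have e := split_one N (fun k => sfun 1 3 x ^ (k + 2)) (c 0) (c 1) (sfun 0 2 x)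
      beta_reduce at e ⊢
      linear_combination this - e)
  have ho01 := half_odd y hy N (o 0) (o 1) (fun b => ∑ k ∈ Finset.range N, b ^ k * o 2 k)
    (fun b => ∑ k ∈ Finset.range N, b ^ k * o 3 k) (by fun_prop) (by fun_prop) (by
      intro x hx
      have := hodd x hx
      have e := split_two N (fun k => sfun 1 3 x ^ k) (o 2) (o 3) (sfun3 0 1 3 x) (sfun3 1 2 3 x)
      beta_reduce at e ⊢
      linear_combination this - e)
  have ho32 := half_odd (shifty y) hys N (o 3) (o 2) (fun b => ∑ k ∈ Finset.range N, b ^ k * o 0 k)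
    (fun b => ∑ k ∈ Finset.range N, b ^ k * o 1 k) (by fun_prop) (by fun_prop) (by
      intro x hx
      have := hodd (shiftx x) (par_shift y x hx)
      obtain ⟨e1, e2, e3, e4, e5, e6⟩ := shift_vals x
      rw [e1, e2, e3, e4, e5, e6] at this
      have e := split_two N (fun k => sfun 1 3 x ^ k) (o 0) (o 1) (sfun3 0 1 3 x) (sfun3 1 2 3 x)
      have e' : ∑ k ∈ Finset.range N, sfun 0 2 x ^ k * (o 2 k * sfun3 0 2 3 x + o 3 k * sfun3 0 1 2 x)
          = ∑ k ∈ Finset.range N, sfun 0 2 x ^ k * (o 3 k * sfun3 0 1 2 x + o 2 k * sfun3 0 2 3 x) :=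
        Finset.sum_congr rfl fun k _ => by ring
      beta_reduce at e ⊢
      linear_combination this - e - e')
  have hg : ∀ k < 2, (fun k : ℕ => if k = 0 then g 0 else g 1) k = 0 ∧
      (fun k : ℕ => if k = 0 then g 2 else g 3) k = 0 := by
    refine low_even y hy _ _ ?_
    intro x hx
    have := heven x hx
    rw [Finset.sum_eq_zero (fun k hk => by
        rw [(hc01 k (Finset.mem_range.mp hk)).1, (hc01 k (Finset.mem_range.mp hk)).2]; ring),
      Finset.sum_eq_zero (fun k hk => by
        rw [(hc23 k (Finset.mem_range.mp hk)).1, (hc23 k (Finset.mem_range.mp hk)).2]; ring)] at this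
    simp only [Finset.sum_range_succ, Finset.sum_range_zero, if_true, one_ne_zero, if_false]
    linear_combination this
  have h0 := hg 0 (by norm_num)
  have h1 := hg 1 (by norm_num)
  simp only [if_true, one_ne_zero, if_false] at h0 h1
  refine ⟨?_, ?_, ?_⟩
  · intro i
    fin_cases i
    exacts [h0.1, h1.1, h0.2, h1.2]
  · intro i k hk
    fin_cases i
    exacts [(hc01 k hk).1, (hc01 k hk).2, (hc23 k hk).1, (hc23 k hk).2]
  · intro i k hk
    fin_cases i
    exacts [(ho01 k hk).1, (ho01 k hk).2, (ho32 k hk).2, (ho32 k hk).1]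

/-! ### Linear independence -/

/-- The index type of the basis. -/
abbrev Idx : Type := Fin 4 ⊕ (Fin 4 × ℕ) ⊕ (Fin 4 × ℕ)

/-- The elements of `Eset`, listed. -/
noncomputable def ebas : Idx → ((Fin 4 → M2) → ℂ) :=
  Sum.elim ![1, sfun 0 2, sfun 1 3, sfun 0 2 * sfun 1 3]
    (Sum.elim
      (fun p => (![sfun 0 2 ^ (p.2 + 2), sfun 0 2 ^ (p.2 + 2) * sfun 1 3,
        sfun 1 3 ^ (p.2 + 2), sfun 1 3 ^ (p.2 + 2) * sfun 0 2] :
          Fin 4 → ((Fin 4 → M2) → ℂ)) p.1)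
      (fun p => (![sfun 0 2 ^ p.2 * sfun3 0 1 2, sfun 0 2 ^ p.2 * sfun3 0 2 3,
        sfun 1 3 ^ p.2 * sfun3 0 1 3, sfun 1 3 ^ p.2 * sfun3 1 2 3] :
          Fin 4 → ((Fin 4 → M2) → ℂ)) p.1))

lemma Eset_sub_range : Eset ⊆ Set.range ebas := by
  rintro f ((hf | ⟨k, hk, hf⟩) | ⟨k, hf⟩)
  · simp only [Set.mem_insert_iff, Set.mem_singleton_iff] at hf
    rcases hf with rfl | rfl | rfl | rfl
    exacts [⟨Sum.inl 0, rfl⟩, ⟨Sum.inl 1, rfl⟩, ⟨Sum.inl 2, rfl⟩, ⟨Sum.inl 3, rfl⟩]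
  · obtain ⟨k, rfl⟩ := Nat.exists_eq_add_of_le' hk
    rcases hf with rfl | rfl | rfl | rfl
    exacts [⟨Sum.inr (Sum.inl (0, k)), rfl⟩, ⟨Sum.inr (Sum.inl (1, k)), rfl⟩,
      ⟨Sum.inr (Sum.inl (2, k)), rfl⟩, ⟨Sum.inr (Sum.inl (3, k)), rfl⟩]
  · rcases hf with rfl | rfl | rfl | rfl
    exacts [⟨Sum.inr (Sum.inr (0, k)), rfl⟩, ⟨Sum.inr (Sum.inr (1, k)), rfl⟩,
      ⟨Sum.inr (Sum.inr (2, k)), rfl⟩, ⟨Sum.inr (Sum.inr (3, k)), rfl⟩]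

lemma Ralg_poly (r : (Fin 4 → M2) → ℂ) (hr : r ∈ Ralg) :
    ∃ P : MvPolynomial (Fin 12) ℂ, ∀ x, r x = MvPolynomial.eval (par x) P := by
  unfold Ralg at hr
  induction hr using Algebra.adjoin_induction with
  | mem f hf =>
    simp only [Set.mem_insert_iff, Set.mem_singleton_iff] at hf
    rcases hf with rfl | rfl | rfl | rfl | rfl | rfl | rfl | rfl | rfl | rfl | rfl | rfl
    exacts [⟨MvPolynomial.X 0, fun x => (MvPolynomial.eval_X (f := par x) 0).symm⟩,
      ⟨MvPolynomial.X 1, fun x => (MvPolynomial.eval_X (f := par x) 1).symm⟩,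
      ⟨MvPolynomial.X 2, fun x => (MvPolynomial.eval_X (f := par x) 2).symm⟩,
      ⟨MvPolynomial.X 3, fun x => (MvPolynomial.eval_X (f := par x) 3).symm⟩,
      ⟨MvPolynomial.X 4, fun x => (MvPolynomial.eval_X (f := par x) 4).symm⟩,
      ⟨MvPolynomial.X 5, fun x => (MvPolynomial.eval_X (f := par x) 5).symm⟩,
      ⟨MvPolynomial.X 6, fun x => (MvPolynomial.eval_X (f := par x) 6).symm⟩,
      ⟨MvPolynomial.X 7, fun x => (MvPolynomial.eval_X (f := par x) 7).symm⟩,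
      ⟨MvPolynomial.X 8, fun x => (MvPolynomial.eval_X (f := par x) 8).symm⟩,
      ⟨MvPolynomial.X 9, fun x => (MvPolynomial.eval_X (f := par x) 9).symm⟩,
      ⟨MvPolynomial.X 10, fun x => (MvPolynomial.eval_X (f := par x) 10).symm⟩,
      ⟨MvPolynomial.X 11, fun x => (MvPolynomial.eval_X (f := par x) 11).symm⟩]
  | algebraMap c => exact ⟨MvPolynomial.C c, fun x => by simp⟩
  | add f g _ _ hf hg =>
    obtain ⟨P, hP⟩ := hf
    obtain ⟨Q, hQ⟩ := hg
    exact ⟨P + Q, fun x => by rw [Pi.add_apply, hP, hQ, map_add]⟩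
  | mul f g _ _ hf hg =>
    obtain ⟨P, hP⟩ := hf
    obtain ⟨Q, hQ⟩ := hg
    exact ⟨P * Q, fun x => by rw [Pi.mul_apply, hP, hQ, map_mul]⟩

lemma poly_zero (P : MvPolynomial (Fin 12) ℂ)
    (h : ∀ y : Fin 12 → ℂ, y 5 * y 7 ≠ 0 → y 4 * y 6 ≠ 0 → MvPolynomial.eval y P = 0) :
    P = 0 := by
  have h1 : P * (MvPolynomial.X 5 * MvPolynomial.X 7 * (MvPolynomial.X 4 * MvPolynomial.X 6)) = 0 := by
    apply MvPolynomial.funext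
    intro y
    simp only [map_mul, MvPolynomial.eval_X, map_zero]
    by_cases h5 : y 5 * y 7 = 0
    · rw [h5]; ring
    by_cases h4 : y 4 * y 6 = 0
    · rw [h4]; ring
    rw [h y h5 h4, zero_mul]
  refine (mul_eq_zero.mp h1).resolve_right ?_
  simp [MvPolynomial.X_ne_zero]

lemma ebas_indep : LinearIndependent Ralg ebas := by
  rw [linearIndependent_iff]
  intro l hl
  choose P hP using fun i => Ralg_poly (l i : (Fin 4 → M2) → ℂ) (l i).2
  -- a bound for the exponents
  obtain ⟨N, hN⟩ : ∃ N : ℕ, ∀ i ∈ l.support, Sum.elim (fun _ => 0)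
      (Sum.elim (fun p : Fin 4 × ℕ => p.2 + 1) (fun p : Fin 4 × ℕ => p.2 + 1)) i ≤ N :=
    ⟨l.support.sup _, fun i hi => Finset.le_sup (f := Sum.elim (fun _ => 0)
      (Sum.elim (fun p : Fin 4 × ℕ => p.2 + 1) (fun p : Fin 4 × ℕ => p.2 + 1))) hi⟩
  have hsub : l.support ⊆ (Finset.univ : Finset (Fin 4)).disjSum
      ((Finset.univ ×ˢ Finset.range N : Finset (Fin 4 × ℕ)).disjSum
        (Finset.univ ×ˢ Finset.range N : Finset (Fin 4 × ℕ))) := by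
    intro i hi
    have := hN i hi
    rcases i with i | ⟨i, k⟩ | ⟨i, k⟩
    · simp
    · simpa using this
    · simpa using this
  rw [Finsupp.linearCombination_apply, Finsupp.sum_of_support_subset l hsub _ (by simp),
    Finset.sum_disjSum, Finset.sum_disjSum, Finset.sum_product, Finset.sum_product,
    Fin.sum_univ_four, Fin.sum_univ_four, Fin.sum_univ_four] at hl
  have hval : ∀ x, ∀ i, (l i • ebas i) x = MvPolynomial.eval (par x) (P i) * ebas i x := by
    intro x i
    rw [← hP i x]
    rfl
  have hx : ∀ y : Fin 12 → ℂ, y 5 * y 7 ≠ 0 → y 4 * y 6 ≠ 0 →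
      (∀ i, MvPolynomial.eval y (P (Sum.inl i)) = 0) ∧
      (∀ i, ∀ k < N, MvPolynomial.eval y (P (Sum.inr (Sum.inl (i, k)))) = 0) ∧
      (∀ i, ∀ k < N, MvPolynomial.eval y (P (Sum.inr (Sum.inr (i, k)))) = 0) := by
    intro y h5 h4
    refine core y h5 h4 N (fun i => MvPolynomial.eval y (P (Sum.inl i)))
      (fun i k => MvPolynomial.eval y (P (Sum.inr (Sum.inl (i, k)))))
      (fun i k => MvPolynomial.eval y (P (Sum.inr (Sum.inr (i, k))))) ?_
    intro x hx
    have h1 := congrFun hl x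
    simp only [Pi.add_apply, Finset.sum_apply, hval, hx, Pi.zero_apply] at h1
    simp only [ebas, Sum.elim_inl, Sum.elim_inr, Matrix.cons_val, Pi.one_apply,
      Pi.mul_apply, Pi.pow_apply] at h1
    simp only [mul_add, Finset.sum_add_distrib]
    rw [← h1]
    have e1 : ∀ (F : ℕ → ℂ) (a b : ℂ) (n : ℕ), ∑ k ∈ Finset.range N, a ^ (k + n) * (F k * b)
      = ∑ k ∈ Finset.range N, F k * (a ^ (k + n) * b) := fun F a b n =>
        Finset.sum_congr rfl fun k _ => by ring
    have e2 : ∀ (F : ℕ → ℂ) (a : ℂ) (n : ℕ), ∑ k ∈ Finset.range N, a ^ (k + n) * F k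
      = ∑ k ∈ Finset.range N, F k * a ^ (k + n) := fun F a n =>
        Finset.sum_congr rfl fun k _ => by ring
    have e3 : ∀ (F : ℕ → ℂ) (a b : ℂ), ∑ k ∈ Finset.range N, a ^ k * (F k * b)
      = ∑ k ∈ Finset.range N, F k * (a ^ k * b) := fun F a b =>
        Finset.sum_congr rfl fun k _ => by ring
    rw [e1, e1, e2, e2, e3, e3, e3, e3]
    ring
  ext1 i
  have hz : P i = 0 ∨ l i = 0 := by
    rcases i with i | ⟨i, k⟩ | ⟨i, k⟩
    · exact Or.inl (poly_zero _ fun y h5 h4 => (hx y h5 h4).1 i)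
    · by_cases hk : k < N
      · exact Or.inl (poly_zero _ fun y h5 h4 => (hx y h5 h4).2.1 i k hk)
      · right
        by_contra hne
        exact hk (hN _ (Finsupp.mem_support_iff.mpr hne))
    · by_cases hk : k < N
      · exact Or.inl (poly_zero _ fun y h5 h4 => (hx y h5 h4).2.2 i k hk)
      · right
        by_contra hne
        exact hk (hN _ (Finsupp.mem_support_iff.mpr hne))
  rcases hz with hz | hz
  · apply Subtype.ext
    funext x
    rw [hP i x, hz]
    simp
  · exact hz

lemma Eset_indep : LinearIndependent Ralg ((↑) : Eset → ((Fin 4 → M2) → ℂ)) :=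
  (ebas_indep.linearIndepOn_id).mono Eset_sub_range

/-- `T₄` is a free `R`-module with basis `E`: the elements of `E` lie in `T₄`,
they are linearly independent over `R`, and they span `T₄` over `R`. -/
theorem stmt_1 :
    (Eset ⊆ (T4 : Set ((Fin 4 → M2) → ℂ))) ∧
    LinearIndependent Ralg ((↑) : Eset → ((Fin 4 → M2) → ℂ)) ∧
    ∀ f ∈ T4, f ∈ Submodule.span Ralg Eset := by

  exact ⟨Eset_subset, Eset_indep, T4_span⟩
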